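/- arXiv:2509.16997 — 4 statements merged into one kernel-verified Lean document; each statement's English description precedes it below -/
import Mathlib

section
/- Let N ≥ 1, let V be a real polynomial, and let λ₁, …, λ_N be pairwise distinct real numbers satisfying the saddle-point equations V'(λᵢ) = (2/N)·∑_{j ≠ i} 1/(λᵢ − λⱼ) for every i. For real x with x ≠ λᵢ for all i, define W(x) = (1/N)·∑_{i=1}^N 1/(x − λᵢ) and P(x) = (1/N)·∑_{i=1}^N (V'(x) − V'(λᵢ))/(x − λᵢ). Then W(x)² − (1/N²)·∑_{i=1}^N 1/(x − λᵢ)² = V'(x)·W(x) − P(x). -/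
open Finset Polynomial

/-- The partial-fraction identity
`(∑ᵢ 1/(x - lᵢ))² - ∑ᵢ 1/(x - lᵢ)² = 2 ∑ᵢ ∑_{j ≠ i} 1/((lᵢ - lⱼ)(x - lᵢ))`. -/
theorem sq_sum_inv_sub_sum_inv_sq {ι K : Type*} [Fintype ι] [DecidableEq ι] [Field K]
    (l : ι → K) (hl : Function.Injective l) (x : K) (hx : ∀ i, x ≠ l i) :
    (∑ i, 1 / (x - l i)) ^ 2 - ∑ i, 1 / (x - l i) ^ 2
      = 2 * ∑ i, (∑ j ∈ Finset.univ.erase i, 1 / (l i - l j)) / (x - l i) := by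
  have herase : ∀ i, ∑ j ∈ Finset.univ.erase i, 1 / (l i - l j) = ∑ j, 1 / (l i - l j) :=
    fun i => Finset.sum_erase _ (by simp)
  have hdiag : ∑ i, 1 / (x - l i) ^ 2
      = ∑ i, ∑ j, if i = j then 1 / (x - l i) ^ 2 else 0 := by
    simp
  have hsymm : 2 * ∑ i, ∑ j, 1 / (l i - l j) / (x - l i)
      = ∑ i, ∑ j, (1 / (l i - l j) / (x - l i) + 1 / (l j - l i) / (x - l j)) := by
    simp only [Finset.sum_add_distrib]
    rw [two_mul]
    congr 1
    exact Finset.sum_comm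
  simp only [herase, Finset.sum_div]
  rw [hsymm, hdiag, sq, Finset.sum_mul_sum, ← Finset.sum_sub_distrib]
  refine Finset.sum_congr rfl fun i _ => ?_
  rw [← Finset.sum_sub_distrib]
  refine Finset.sum_congr rfl fun j _ => ?_
  have hi := sub_ne_zero.mpr (hx i)
  have hj := sub_ne_zero.mpr (hx j)
  by_cases hij : i = j
  · subst hij
    simp [sq]
  · have hlij : l i - l j ≠ 0 := sub_ne_zero.mpr (hl.ne hij)
    rw [if_neg hij, ← neg_sub (l i) (l j)]
    field_simp
    ring

theorem finite_N_riccati (N : ℕ) (hN : 1 ≤ N) (V : Polynomial ℝ) (l : Fin N → ℝ)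
    (hl : Function.Injective l)
    (hsaddle : ∀ i, V.derivative.eval (l i)
      = (2 / (N : ℝ)) * ∑ j ∈ Finset.univ.erase i, 1 / (l i - l j))
    (x : ℝ) (hx : ∀ i, x ≠ l i) :
    ((1 / (N : ℝ)) * ∑ i, 1 / (x - l i)) ^ 2
      - (1 / (N : ℝ) ^ 2) * ∑ i, 1 / (x - l i) ^ 2
    = V.derivative.eval x * ((1 / (N : ℝ)) * ∑ i, 1 / (x - l i))
      - (1 / (N : ℝ)) * ∑ i, (V.derivative.eval x - V.derivative.eval (l i)) / (x - l i) := by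
  have key := sq_sum_inv_sub_sum_inv_sq l hl x hx
  have hsum : ∑ i, V.derivative.eval (l i) / (x - l i)
      = 2 / (N : ℝ) * ∑ i, (∑ j ∈ Finset.univ.erase i, 1 / (l i - l j)) / (x - l i) := by
    rw [Finset.mul_sum]
    exact Finset.sum_congr rfl fun i _ => by rw [hsaddle i, mul_div_assoc]
  have hsplit : ∑ i, (V.derivative.eval x - V.derivative.eval (l i)) / (x - l i)
      = V.derivative.eval x * ∑ i, 1 / (x - l i)
        - ∑ i, V.derivative.eval (l i) / (x - l i) := by
    rw [Finset.mul_sum, ← Finset.sum_sub_distrib]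
    exact Finset.sum_congr rfl fun i _ => by ring
  rw [hsplit, hsum]
  linear_combination (1 / (N : ℝ) ^ 2) * key
end

section
/- Let g be real with 0 < g < 1/4, set r = (−1 + 4g + √(1 − 4g)) / (8g − 2) (real square root), and define j(g) = 256·(r² − r + 1)³ / (r²·(r − 1)²). Then j(g) = 256·(1 − 3g)³ / (g²·(1 − 4g)). -/
theorem j_invariant_closed_form (g : ℝ) (hg0 : 0 < g) (hg1 : g < 1 / 4)
    (r : ℝ) (hr : r = (-1 + 4 * g + Real.sqrt (1 - 4 * g)) / (8 * g - 2)) :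
    256 * (r ^ 2 - r + 1) ^ 3 / (r ^ 2 * (r - 1) ^ 2)
      = 256 * (1 - 3 * g) ^ 3 / (g ^ 2 * (1 - 4 * g)) := by
  have hd : 1 - 4 * g ≠ 0 := by linarith
  have hd' : 8 * g - 2 ≠ 0 := by linarith
  have hs : Real.sqrt (1 - 4 * g) ^ 2 = 1 - 4 * g := Real.sq_sqrt (by linarith)
  have hr' : r * (8 * g - 2) = -1 + 4 * g + Real.sqrt (1 - 4 * g) := by
    rw [hr, div_mul_cancel₀ _ hd']
  have hprod : r * (r - 1) = g / (1 - 4 * g) := by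
    rw [eq_div_iff hd]
    apply mul_left_cancel₀ hd
    have h : (r * (8 * g - 2) - (-1 + 4 * g)) ^ 2 = 1 - 4 * g := by
      rw [hr', add_sub_cancel_left, hs]
    linear_combination h / 4
  have hnum : r ^ 2 - r + 1 = (1 - 3 * g) / (1 - 4 * g) := by
    rw [eq_div_iff hd] at hprod ⊢
    linear_combination hprod
  rw [← mul_pow, hprod, hnum]
  field_simp
end

section
/- For every real g with 0 < g < 1/4, one has 256·(1 − 3g)³ / (g²·(1 − 4g)) ≥ 1728, with equality if and only if g = 2/9. In particular, there is exactly one coupling g in (0, 1/4), namely g = 2/9, at which the spectral curve of the two-cut quartic matrix model has j-invariant 1728 (the CM point of discriminant −4, corresponding to the square lattice). -/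
theorem j_invariant_min (g : ℝ) (hg0 : 0 < g) (hg1 : g < 1 / 4) :
    256 * (1 - 3 * g) ^ 3 / (g ^ 2 * (1 - 4 * g)) ≥ 1728
      ∧ (256 * (1 - 3 * g) ^ 3 / (g ^ 2 * (1 - 4 * g)) = 1728 ↔ g = 2 / 9) := by
  have hden : 0 < g ^ 2 * (1 - 4 * g) := mul_pos (by positivity) (by linarith)
  have hsq : 256 * (1 - 3 * g) ^ 3 - 1728 * (g ^ 2 * (1 - 4 * g)) = 64 * (9 * g - 2) ^ 2 := by
    ring
  refine ⟨?_, ?_⟩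
  · rw [ge_iff_le, le_div_iff₀ hden]
    linarith [sq_nonneg (9 * g - 2)]
  · rw [div_eq_iff hden.ne']
    constructor
    · intro h
      have hzero : 9 * g - 2 = 0 := pow_eq_zero_iff two_ne_zero |>.mp (by linarith)
      linarith
    · rintro rfl
      norm_num
end

section
/- Define j(g) = 256·(1 − 3g)³ / (g²·(1 − 4g)) for real g in (0, 1/4). Then for each J in the set {1728, 8000, 54000, 287496, 16581375}, there exists g ∈ (0, 1/4) with j(g) = J. -/
/-- The modular invariant attains every real value `J ≥ 1728` on `(0, 1/4)`; its value at
`g = 2/9` is exactly `1728`. -/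
theorem exists_coupling_of_le {J : ℝ} (hJ : 1728 ≤ J) :
    ∃ g ∈ Set.Ioo (0 : ℝ) (1 / 4),
      256 * (1 - 3 * g) ^ 3 / (g ^ 2 * (1 - 4 * g)) = J := by
  have hcont : ContinuousOn
      (fun g : ℝ => 256 * (1 - 3 * g) ^ 3 - J * (g ^ 2 * (1 - 4 * g))) (Set.Icc 0 (2 / 9)) := by
    fun_prop
  obtain ⟨g, ⟨hg0, hg1⟩, hg⟩ := intermediate_value_Icc' (by norm_num) hcont
    (show (0 : ℝ) ∈ Set.Icc _ _ by constructor <;> norm_num <;> linarith)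
  have hpos : 0 < g := by
    refine hg0.lt_of_ne ?_
    rintro rfl
    norm_num at hg
  have hlt : g < 1 / 4 := by linarith
  refine ⟨g, ⟨hpos, hlt⟩, ?_⟩
  have hden : 0 < g ^ 2 * (1 - 4 * g) := mul_pos (by positivity) (by linarith)
  rw [div_eq_iff hden.ne']
  exact sub_eq_zero.mp hg

theorem cm_values_attained :
    ∀ J ∈ ({1728, 8000, 54000, 287496, 16581375} : Set ℝ),
      ∃ g ∈ Set.Ioo (0 : ℝ) (1 / 4),
        256 * (1 - 3 * g) ^ 3 / (g ^ 2 * (1 - 4 * g)) = J := by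
  rintro J (rfl | rfl | rfl | rfl | rfl) <;> exact exists_coupling_of_le (by norm_num)
end
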